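/- For every λ with 0 < λ ≤ 1 and every Δ ≥ 0, R_cut^{(λ)}(Δ|P) = sup over μ ≥ 0 of { (1/λ)·Ω^{(μ,λ)}(P) − (μ/λ)·Δ }. -/

import Mathlib

open Real Filter

noncomputable section

def IsDist {X : Type*} [Fintype X] (P : X → ℝ) : Prop :=
  (∀ x, 0 ≤ P x) ∧ ∑ x, P x = 1

def IsJoint {X Y : Type*} [Fintype X] [Fintype Y] (q : X → Y → ℝ) : Prop :=
  (∀ x y, 0 ≤ q x y) ∧ ∑ x, ∑ y, q x y = 1

def IsCond {X Y : Type*} [Fintype X] [Fintype Y] (V : X → Y → ℝ) : Prop :=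
  (∀ x y, 0 ≤ V x y) ∧ ∀ x, ∑ y, V x y = 1

def margX {X Y : Type*} [Fintype Y] (q : X → Y → ℝ) (x : X) : ℝ := ∑ y, q x y

def margY {X Y : Type*} [Fintype X] (q : X → Y → ℝ) (y : Y) : ℝ := ∑ x, q x y

/-- conditional distribution of `X` given `Y` : `q_{X|Y}(x|y)` -/
def condXY {X Y : Type*} [Fintype X] (q : X → Y → ℝ) (x : X) (y : Y) : ℝ :=
  q x y / margY q y

/-- conditional distribution of `Y` given `X` : `q_{Y|X}(y|x)` -/
def condYX {X Y : Type*} [Fintype Y] (q : X → Y → ℝ) (x : X) (y : Y) : ℝ :=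
  q x y / margX q x

/-- mutual information `I(q_X, q_{Y|X})` of a joint distribution `q` -/
def mutInfo {X Y : Type*} [Fintype X] [Fintype Y] (q : X → Y → ℝ) : ℝ :=
  ∑ x, ∑ y, q x y * Real.log (q x y / (margX q x * margY q y))

/-- divergence `D(q_X ‖ P)` -/
def klX {X Y : Type*} [Fintype X] [Fintype Y] (q : X → Y → ℝ) (P : X → ℝ) : ℝ :=
  ∑ x, margX q x * Real.log (margX q x / P x)

/-- divergence `D(p ‖ q)` of distributions on `X` -/
def klD {X : Type*} [Fintype X] (p q : X → ℝ) : ℝ :=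
  ∑ x, p x * Real.log (p x / q x)

/-- divergence `D(q ‖ p)` of joint distributions -/
def klJoint {X Y : Type*} [Fintype X] [Fintype Y] (q p : X → Y → ℝ) : ℝ :=
  ∑ x, ∑ y, q x y * Real.log (q x y / p x y)

/-- expected distortion `E_q[d(X,Y)]` -/
def Ed {X Y : Type*} [Fintype X] [Fintype Y] (q d : X → Y → ℝ) : ℝ :=
  ∑ x, ∑ y, q x y * d x y

/-- `G(R,Δ|P)` -/
def G {X Y : Type*} [Fintype X] [Fintype Y] (P : X → ℝ) (d : X → Y → ℝ) (R Δ : ℝ) : ℝ :=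
  sInf {v : ℝ | ∃ q : X → Y → ℝ, IsJoint q ∧ Ed q d ≤ Δ ∧
    v = max 0 (mutInfo q - R) + klX q P}

/-- `G^{(λ)}(R,Δ|P)` -/
def Glam {X Y : Type*} [Fintype X] [Fintype Y] (P : X → ℝ) (d : X → Y → ℝ)
    (lam R Δ : ℝ) : ℝ :=
  sInf {v : ℝ | ∃ q : X → Y → ℝ, IsJoint q ∧ Ed q d ≤ Δ ∧
    v = lam * (mutInfo q - R) + klX q P}

/-- rate distortion function `R(Δ|P)` -/
def RD {X Y : Type*} [Fintype X] [Fintype Y] (P : X → ℝ) (d : X → Y → ℝ) (Δ : ℝ) : ℝ :=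
  sInf {v : ℝ | ∃ V : X → Y → ℝ, IsCond V ∧ Ed (fun x y => P x * V x y) d ≤ Δ ∧
    v = mutInfo (fun x y => P x * V x y)}

/-- `Ω^{(μ,λ)}(P)` -/
def OmegaF {X Y : Type*} [Fintype X] [Fintype Y] (P : X → ℝ) (d : X → Y → ℝ)
    (μ lam : ℝ) : ℝ :=
  sInf {v : ℝ | ∃ q : X → Y → ℝ, IsJoint q ∧
    v = lam * mutInfo q + klX q P + μ * Ed q d}

/-- `G^{(μ,λ)}(R,Δ|P) = Ω^{(μ,λ)}(P) − λR − μΔ` -/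
def Gmulam {X Y : Type*} [Fintype X] [Fintype Y] (P : X → ℝ) (d : X → Y → ℝ)
    (μ lam R Δ : ℝ) : ℝ :=
  OmegaF P d μ lam - lam * R - μ * Δ

/-- `ω_q^{(μ,λ)}(x,y)` -/
def omg {X Y : Type*} [Fintype X] [Fintype Y] (P : X → ℝ) (d : X → Y → ℝ)
    (μ lam : ℝ) (q : X → Y → ℝ) (x : X) (y : Y) : ℝ :=
  Real.log (margX q x ^ (1 - lam) * condXY q x y ^ lam * Real.exp (μ * d x y) / P x)

/-- `F^{(μ,λ)}(p,q) = E_q[ω_p^{(μ,λ)}(X,Y)] + D(q‖p)` -/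
def Ffun {X Y : Type*} [Fintype X] [Fintype Y] (P : X → ℝ) (d : X → Y → ℝ)
    (μ lam : ℝ) (p q : X → Y → ℝ) : ℝ :=
  (∑ x, ∑ y, q x y * omg P d μ lam p x y) + klJoint q p

/-- `Λ_p^{(μ,λ)} = E_p[exp(−ω_p^{(μ,λ)}(X,Y))]` -/
def Lam {X Y : Type*} [Fintype X] [Fintype Y] (P : X → ℝ) (d : X → Y → ℝ)
    (μ lam : ℝ) (p : X → Y → ℝ) : ℝ :=
  ∑ x, ∑ y, p x y * Real.exp (-(omg P d μ lam p x y))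

/-- cutoff rate `R_cut^{(λ)}(Δ|P)` -/
def Rcut {X Y : Type*} [Fintype X] [Fintype Y] (P : X → ℝ) (d : X → Y → ℝ)
    (lam Δ : ℝ) : ℝ :=
  sInf {v : ℝ | ∃ q : X → Y → ℝ, IsJoint q ∧ Ed q d ≤ Δ ∧
    v = mutInfo q + (1 / lam) * klX q P}

/-- Shannon entropy -/
def entropy {X : Type*} [Fintype X] (p : X → ℝ) : ℝ :=
  -∑ x, p x * Real.log (p x)

theorem log_sum_two {a₁ b₁ a₂ b₂ s t : ℝ} (ha₁ : 0 ≤ a₁) (ha₂ : 0 ≤ a₂) (hab₁ : a₁ ≤ b₁)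
    (hab₂ : a₂ ≤ b₂) (hs : 0 ≤ s) (ht : 0 ≤ t) :
    (s * a₁ + t * a₂) * Real.log ((s * a₁ + t * a₂) / (s * b₁ + t * b₂)) ≤
      s * (a₁ * Real.log (a₁ / b₁)) + t * (a₂ * Real.log (a₂ / b₂)) := by
  have tangent : ∀ a b c : ℝ, 0 ≤ a → a ≤ b → 0 < c →
      a * Real.log c + a - c * b ≤ a * Real.log (a / b) := by
    intro a b c ha hab hc
    rcases ha.eq_or_lt with rfl | ha
    · simpa using mul_nonneg hc.le hab
    · have hb : 0 < b := ha.trans_le hab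
      have h := Real.log_le_sub_one_of_pos (show 0 < c * b / a by positivity)
      rw [Real.log_div (by positivity) ha.ne', Real.log_mul hc.ne' hb.ne'] at h
      rw [Real.log_div ha.ne' hb.ne']
      have h2 := mul_le_mul_of_nonneg_left h ha.le
      have h3 : a * (c * b / a - 1) = c * b - a := by field_simp
      rw [h3] at h2
      linarith
  have hsa := mul_nonneg hs ha₁
  have hta := mul_nonneg ht ha₂
  rcases (add_nonneg hsa hta).eq_or_lt with h0 | hpos
  · have h1 : s * a₁ = 0 := by linarith
    have h2 : t * a₂ = 0 := by linarith
    simp [← mul_assoc, h1, h2]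
  · have hb : 0 < s * b₁ + t * b₂ := hpos.trans_le
      (add_le_add (mul_le_mul_of_nonneg_left hab₁ hs) (mul_le_mul_of_nonneg_left hab₂ ht))
    set c := (s * a₁ + t * a₂) / (s * b₁ + t * b₂) with hc
    have hcpos : 0 < c := div_pos hpos hb
    have hcb : c * (s * b₁ + t * b₂) = s * a₁ + t * a₂ := by rw [hc]; field_simp
    have h1 := mul_le_mul_of_nonneg_left (tangent a₁ b₁ c ha₁ hab₁ hcpos) hs
    have h2 := mul_le_mul_of_nonneg_left (tangent a₂ b₂ c ha₂ hab₂ hcpos) ht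
    nlinarith

theorem margX_combo {X Y : Type*} [Fintype Y] (s t : ℝ) (p q : X → Y → ℝ) (x : X) :
    margX (s • p + t • q) x = s * margX p x + t * margX q x := by
  simp [margX, Finset.sum_add_distrib, Finset.mul_sum]

theorem margY_combo {X Y : Type*} [Fintype X] (s t : ℝ) (p q : X → Y → ℝ) (y : Y) :
    margY (s • p + t • q) y = s * margY p y + t * margY q y := by
  simp [margY, Finset.sum_add_distrib, Finset.mul_sum]

section

variable {X Y : Type*} [Fintype X] [Fintype Y]

theorem le_margX {q : X → Y → ℝ} (hq : IsJoint q) (x : X) (y : Y) : q x y ≤ margX q x :=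
  Finset.single_le_sum (f := fun y => q x y) (fun y _ => hq.1 x y) (Finset.mem_univ y)

theorem le_margY {q : X → Y → ℝ} (hq : IsJoint q) (x : X) (y : Y) : q x y ≤ margY q y :=
  Finset.single_le_sum (f := fun x => q x y) (fun x _ => hq.1 x y) (Finset.mem_univ x)

theorem mutInfo_eq {q : X → Y → ℝ} (hq : IsJoint q) :
    mutInfo q = (∑ x, ∑ y, q x y * Real.log (q x y / margY q y)) -
      ∑ x, margX q x * Real.log (margX q x) := by
  have h : ∀ x, margX q x * Real.log (margX q x) = ∑ y, q x y * Real.log (margX q x) :=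
    fun x => by rw [← Finset.sum_mul]; rfl
  simp only [mutInfo, h, ← Finset.sum_sub_distrib]
  refine Finset.sum_congr rfl fun x _ => Finset.sum_congr rfl fun y _ => ?_
  rcases (hq.1 x y).eq_or_lt with h0 | h0
  · simp [← h0]
  · have hx := h0.trans_le (le_margX hq x y)
    have hy := h0.trans_le (le_margY hq x y)
    rw [Real.log_div h0.ne' (mul_pos hx hy).ne', Real.log_mul hx.ne' hy.ne',
      Real.log_div h0.ne' hy.ne']
    ring

theorem klX_eq {P : X → ℝ} (hP : ∀ x, 0 < P x) (q : X → Y → ℝ) :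
    klX q P = (∑ x, margX q x * Real.log (margX q x)) - ∑ x, margX q x * Real.log (P x) := by
  rw [klX, ← Finset.sum_sub_distrib]
  refine Finset.sum_congr rfl fun x _ => ?_
  by_cases h : margX q x = 0
  · simp [h]
  · rw [Real.log_div h (hP x).ne', mul_sub]

theorem sum_mul_log_div_margY {q : X → Y → ℝ} (hq : IsJoint q) :
    ∑ x, ∑ y, q x y * Real.log (q x y / margY q y) =
      (∑ x, ∑ y, q x y * Real.log (q x y)) - ∑ y, margY q y * Real.log (margY q y) := by
  have h : ∀ y, margY q y * Real.log (margY q y) = ∑ x, q x y * Real.log (margY q y) :=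
    fun y => by rw [← Finset.sum_mul]; rfl
  simp only [h]
  rw [Finset.sum_comm (γ := Y) (f := fun y x => q x y * Real.log (margY q y)),
    ← Finset.sum_sub_distrib]
  refine Finset.sum_congr rfl fun x _ => ?_
  rw [← Finset.sum_sub_distrib]
  refine Finset.sum_congr rfl fun y _ => ?_
  rcases (hq.1 x y).eq_or_lt with h0 | h0
  · simp [← h0]
  · rw [Real.log_div h0.ne' (h0.trans_le (le_margY hq x y)).ne', mul_sub]

/-- the objective `I(q_X, q_{Y|X}) + c · D(q_X ‖ P)` of the cutoff rate -/
def cutoffObjective (P : X → ℝ) (c : ℝ) (q : X → Y → ℝ) : ℝ := mutInfo q + c * klX q P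

theorem cutoffObjective_eq {P : X → ℝ} (hP : ∀ x, 0 < P x) (c : ℝ) {q : X → Y → ℝ}
    (hq : IsJoint q) :
    cutoffObjective P c q = (∑ x, ∑ y, q x y * Real.log (q x y / margY q y)) +
      (c - 1) * (∑ x, margX q x * Real.log (margX q x)) -
      c * ∑ x, margX q x * Real.log (P x) := by
  rw [cutoffObjective, mutInfo_eq hq, klX_eq hP]
  ring

theorem continuousOn_cutoffObjective {P : X → ℝ} (hP : ∀ x, 0 < P x) (c : ℝ) :
    ContinuousOn (cutoffObjective P c) {q : X → Y → ℝ | IsJoint q} := by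
  have h : Continuous fun q : X → Y → ℝ => (∑ x, ∑ y, q x y * Real.log (q x y)) -
      (∑ y, margY q y * Real.log (margY q y)) +
      (c - 1) * (∑ x, margX q x * Real.log (margX q x)) -
      c * ∑ x, margX q x * Real.log (P x) := by
    have hl : ∀ φ : (X → Y → ℝ) → ℝ, Continuous φ →
        Continuous fun q => φ q * Real.log (φ q) :=
      fun φ hφ => Real.continuous_mul_log.comp hφ
    have hX : ∀ x, Continuous fun q : X → Y → ℝ => margX q x := fun x => by
      unfold margX; fun_prop
    have hY : ∀ y, Continuous fun q : X → Y → ℝ => margY q y := fun y => by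
      unfold margY; fun_prop
    refine Continuous.sub (Continuous.add (Continuous.sub ?_ ?_) ?_) ?_
    · exact continuous_finsetSum _ fun x _ => continuous_finsetSum _ fun y _ =>
        hl _ (by fun_prop)
    · exact continuous_finsetSum _ fun y _ => hl _ (hY y)
    · exact continuous_const.mul (continuous_finsetSum _ fun x _ => hl _ (hX x))
    · exact continuous_const.mul (continuous_finsetSum _ fun x _ => (hX x).mul continuous_const)
  refine h.continuousOn.congr fun q hq => ?_
  rw [cutoffObjective_eq hP c hq, sum_mul_log_div_margY hq]

theorem Ed_combo (s t : ℝ) (p q d : X → Y → ℝ) :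
    Ed (s • p + t • q) d = s * Ed p d + t * Ed q d := by
  simp [Ed, Finset.sum_add_distrib, Finset.mul_sum, add_mul, mul_assoc]

theorem convex_setOf_isJoint : Convex ℝ {q : X → Y → ℝ | IsJoint q} := by
  intro p hp q hq s t hs ht hst
  refine ⟨fun x y => add_nonneg (mul_nonneg hs (hp.1 x y)) (mul_nonneg ht (hq.1 x y)), ?_⟩
  have h : ∑ x, margX (s • p + t • q) x = s * ∑ x, margX p x + t * ∑ x, margX q x := by
    simp only [margX_combo, Finset.sum_add_distrib, Finset.mul_sum]
  have h1 : ∑ x, margX p x = 1 := hp.2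
  have h2 : ∑ x, margX q x = 1 := hq.2
  rw [h1, h2, mul_one, mul_one, hst] at h
  exact h

theorem isCompact_setOf_isJoint : IsCompact {q : X → Y → ℝ | IsJoint q} := by
  refine (isCompact_Icc (a := (0 : X → Y → ℝ)) (b := 1)).of_isClosed_subset ?_ ?_
  · have h : {q : X → Y → ℝ | IsJoint q} =
        (⋂ x, ⋂ y, {q | 0 ≤ q x y}) ∩ {q | ∑ x, ∑ y, q x y = 1} := by
      ext q; simp [IsJoint]
    rw [h]
    exact (isClosed_iInter fun x => isClosed_iInter fun y =>
      isClosed_le continuous_const (by fun_prop)).inter (isClosed_eq (by fun_prop) (by fun_prop))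
  · intro q hq
    refine ⟨fun x y => hq.1 x y, fun x y => (le_margX hq x y).trans ?_⟩
    exact (Finset.single_le_sum (f := fun x => margX q x)
      (fun x _ => Finset.sum_nonneg fun y _ => hq.1 x y) (Finset.mem_univ x)).trans_eq hq.2

theorem convexOn_cutoffObjective {P : X → ℝ} (hP : ∀ x, 0 < P x) {c : ℝ} (hc : 1 ≤ c) :
    ConvexOn ℝ {q : X → Y → ℝ | IsJoint q} (cutoffObjective P c) := by
  refine ⟨convex_setOf_isJoint, ?_⟩
  intro p hp q hq s t hs ht hst
  have hpq := convex_setOf_isJoint hp hq hs ht hst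
  rw [cutoffObjective_eq hP c hp, cutoffObjective_eq hP c hq, cutoffObjective_eq hP c hpq]
  have h1 : ∑ x, ∑ y, (s • p + t • q) x y *
        Real.log ((s • p + t • q) x y / margY (s • p + t • q) y) ≤
      s * (∑ x, ∑ y, p x y * Real.log (p x y / margY p y)) +
      t * (∑ x, ∑ y, q x y * Real.log (q x y / margY q y)) := by
    simp only [Finset.mul_sum, ← Finset.sum_add_distrib, margY_combo]
    exact Finset.sum_le_sum fun x _ => Finset.sum_le_sum fun y _ =>
      log_sum_two (hp.1 x y) (hq.1 x y) (le_margY hp x y) (le_margY hq x y) hs ht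
  have h2 : ∑ x, margX (s • p + t • q) x * Real.log (margX (s • p + t • q) x) ≤
      s * (∑ x, margX p x * Real.log (margX p x)) +
      t * (∑ x, margX q x * Real.log (margX q x)) := by
    simp only [Finset.mul_sum, ← Finset.sum_add_distrib, margX_combo]
    exact Finset.sum_le_sum fun x _ => Real.convexOn_mul_log.2
      (show 0 ≤ margX p x from Finset.sum_nonneg fun y _ => hp.1 x y)
      (show 0 ≤ margX q x from Finset.sum_nonneg fun y _ => hq.1 x y) hs ht hst
  have h3 : ∑ x, margX (s • p + t • q) x * Real.log (P x) =
      s * (∑ x, margX p x * Real.log (P x)) + t * (∑ x, margX q x * Real.log (P x)) := by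
    simp only [Finset.mul_sum, ← Finset.sum_add_distrib, margX_combo]
    exact Finset.sum_congr rfl fun x _ => by ring
  have h4 := mul_le_mul_of_nonneg_left h2 (sub_nonneg.2 hc)
  rw [h3, smul_eq_mul, smul_eq_mul]
  linarith

theorem continuous_Ed (d : X → Y → ℝ) : Continuous fun q : X → Y → ℝ => Ed q d := by
  unfold Ed; fun_prop

theorem exists_isJoint_Ed_eq_zero {P : X → ℝ} (hP : IsDist P) {d : X → Y → ℝ}
    (hd0 : ∀ x, ∃ y, d x y = 0) : ∃ q : X → Y → ℝ, IsJoint q ∧ Ed q d = 0 := by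
  classical
  choose f hf using hd0
  refine ⟨fun x y => if y = f x then P x else 0, ⟨fun x y => ?_, ?_⟩, ?_⟩
  · dsimp only
    split_ifs
    exacts [hP.1 x, le_rfl]
  · simpa using hP.2
  · simp [Ed, hf]

end

open scoped Pointwise in
/-- Lagrangian strong duality for a convex program with one affine constraint on a compact set.
No Slater condition is needed, as the multiplier is only asked to be optimal up to a positive
error. -/
theorem exists_multiplier {E : Type*} [AddCommGroup E] [Module ℝ E] [TopologicalSpace E]
    {K : Set E} (hK : IsCompact K) {f g : E → ℝ} (hf : ConvexOn ℝ K f) (hg : ConvexOn ℝ K g)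
    (hfc : ContinuousOn f K) (hgc : ContinuousOn g K) {b r : ℝ}
    (hfeas : ∃ x ∈ K, g x ≤ b) (hr : ∀ x ∈ K, g x ≤ b → r < f x) :
    ∃ μ : ℝ, 0 ≤ μ ∧ ∀ x ∈ K, r ≤ f x + μ * (g x - b) := by
  let A : Set (ℝ × ℝ) := {z | ∃ x ∈ K, g x ≤ z.1 ∧ f x ≤ z.2}
  have hAconv : Convex ℝ A := by
    rintro z ⟨x, hx, hx1, hx2⟩ w ⟨y, hy, hy1, hy2⟩ s t hs ht hst
    refine ⟨s • x + t • y, hf.1 hx hy hs ht hst,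
      (hg.2 hx hy hs ht hst).trans ?_, (hf.2 hx hy hs ht hst).trans ?_⟩
    · exact add_le_add (mul_le_mul_of_nonneg_left hx1 hs) (mul_le_mul_of_nonneg_left hy1 ht)
    · exact add_le_add (mul_le_mul_of_nonneg_left hx2 hs) (mul_le_mul_of_nonneg_left hy2 ht)
  have hAclosed : IsClosed A := by
    have hA : A = (fun x => (g x, f x)) '' K + Set.Ici (0 : ℝ × ℝ) := by
      ext z
      constructor
      · rintro ⟨x, hx, h1, h2⟩
        exact ⟨_, ⟨x, hx, rfl⟩, z - (g x, f x),
          ⟨sub_nonneg.2 h1, sub_nonneg.2 h2⟩, add_sub_cancel _ _⟩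
      · rintro ⟨_, ⟨x, hx, rfl⟩, w, hw, rfl⟩
        exact ⟨x, hx, le_add_of_nonneg_right hw.1, le_add_of_nonneg_right hw.2⟩
    rw [hA]
    exact isClosed_Ici.add_left_of_isCompact (hK.image_of_continuousOn (hgc.prodMk hfc))
  have hnot : (b, r) ∉ A := fun ⟨x, hx, h1, h2⟩ => (hr x hx h1).not_ge h2
  obtain ⟨φ, u, hu, hφ⟩ := geometric_hahn_banach_point_closed hAconv hAclosed hnot
  have hφ_eq : ∀ z : ℝ × ℝ, φ z = z.1 * φ (1, 0) + z.2 * φ (0, 1) := fun z => by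
    have hz : z = z.1 • ((1 : ℝ), (0 : ℝ)) + z.2 • ((0 : ℝ), (1 : ℝ)) := by ext <;> simp
    conv_lhs => rw [hz]
    rw [map_add, map_smul, map_smul, smul_eq_mul, smul_eq_mul]
  set α := φ (1, 0)
  set β := φ (0, 1)
  rw [hφ_eq] at hu
  have hsep : ∀ x ∈ K, ∀ a c : ℝ, 0 ≤ a → 0 ≤ c →
      b * α + r * β < (g x + a) * α + (f x + c) * β := fun x hx a c ha hc => by
    have h := hφ (g x + a, f x + c)
      ⟨x, hx, le_add_of_nonneg_right ha, le_add_of_nonneg_right hc⟩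
    rw [hφ_eq] at h
    exact hu.trans h
  obtain ⟨x₀, hx₀, hgx₀⟩ := hfeas
  have nonneg_of_ray : ∀ m k γ : ℝ, (∀ a : ℝ, 0 ≤ a → m < k + a * γ) → 0 ≤ γ := by
    intro m k γ h
    by_contra! hγ
    have h1 := h (|k - m| / -γ) (div_nonneg (abs_nonneg _) (neg_pos.2 hγ).le)
    have h2 : |k - m| / -γ * γ = -|k - m| := by
      rw [div_neg, neg_mul, div_mul_cancel₀ _ hγ.ne]
    rw [h2] at h1
    linarith [le_abs_self (k - m)]
  have hα : 0 ≤ α := nonneg_of_ray (b * α + r * β) (g x₀ * α + f x₀ * β) α fun a ha => by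
    linarith [hsep x₀ hx₀ a 0 ha le_rfl]
  have hβ : 0 ≤ β := nonneg_of_ray (b * α + r * β) (g x₀ * α + f x₀ * β) β fun a ha => by
    linarith [hsep x₀ hx₀ 0 a le_rfl ha]
  have hβpos : 0 < β := by
    refine hβ.lt_of_ne fun h0 => ?_
    have h := hsep x₀ hx₀ 0 0 le_rfl le_rfl
    rw [← h0] at h
    linarith [mul_le_mul_of_nonneg_right hgx₀ hα]
  refine ⟨α / β, div_nonneg hα hβ, fun x hx => ?_⟩
  have h := hsep x hx 0 0 le_rfl le_rfl
  refine le_of_mul_le_mul_right ?_ hβpos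
  have h2 : (f x + α / β * (g x - b)) * β = f x * β + α * (g x - b) := by field_simp
  rw [h2]
  linarith

/-- for `0 < λ ≤ 1` and `Δ ≥ 0`,
`R_cut^{(λ)}(Δ|P) = sup_{μ ≥ 0} { (1/λ)Ω^{(μ,λ)}(P) − (μ/λ)Δ }`. -/
theorem stmt17 {X Y : Type*} [Fintype X] [Fintype Y]
    (P : X → ℝ) (hP : IsDist P) (hPpos : ∀ x, 0 < P x)
    (d : X → Y → ℝ) (hd : ∀ x y, 0 ≤ d x y) (hd0 : ∀ x, ∃ y, d x y = 0) :
    ∀ lam Δ : ℝ, 0 < lam → lam ≤ 1 → 0 ≤ Δ →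
      Rcut P d lam Δ =
        sSup {v : ℝ | ∃ μ : ℝ, 0 ≤ μ ∧
          v = (1 / lam) * OmegaF P d μ lam - (μ / lam) * Δ} := by
  intro lam Δ hlam hlam1 hΔ
  have hc : 1 ≤ 1 / lam := (one_le_div hlam).2 hlam1
  have hfc := continuousOn_cutoffObjective (Y := Y) hPpos (1 / lam)
  have hfv := convexOn_cutoffObjective (Y := Y) hPpos hc
  have hK := isCompact_setOf_isJoint (X := X) (Y := Y)
  obtain ⟨q₀, hq₀, hEd₀⟩ := exists_isJoint_Ed_eq_zero hP hd0
  have hEdnn : ∀ q : X → Y → ℝ, IsJoint q → 0 ≤ Ed q d := fun q hq =>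
    Finset.sum_nonneg fun x _ => Finset.sum_nonneg fun y _ => mul_nonneg (hq.1 x y) (hd x y)
  obtain ⟨m, hm⟩ := (hK.image_of_continuousOn hfc).bddBelow
  have hm' : ∀ q : X → Y → ℝ, IsJoint q → m ≤ cutoffObjective P (1 / lam) q :=
    fun q hq => hm ⟨q, hq, rfl⟩
  have hobj : ∀ (μ : ℝ) (q : X → Y → ℝ), lam * mutInfo q + klX q P + μ * Ed q d =
      lam * cutoffObjective P (1 / lam) q + μ * Ed q d := fun μ q => by
    rw [cutoffObjective]; field_simp
  have hRbdd : BddBelow {v : ℝ | ∃ q : X → Y → ℝ, IsJoint q ∧ Ed q d ≤ Δ ∧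
      v = mutInfo q + (1 / lam) * klX q P} := by
    refine ⟨m, ?_⟩
    rintro _ ⟨q, hq, -, rfl⟩
    exact hm' q hq
  have hObdd : ∀ μ : ℝ, 0 ≤ μ → BddBelow {v : ℝ | ∃ q : X → Y → ℝ, IsJoint q ∧
      v = lam * mutInfo q + klX q P + μ * Ed q d} := fun μ hμ => by
    refine ⟨lam * m, ?_⟩
    rintro _ ⟨q, hq, rfl⟩
    rw [hobj]
    exact le_add_of_le_of_nonneg (mul_le_mul_of_nonneg_left (hm' q hq) hlam.le)
      (mul_nonneg hμ (hEdnn q hq))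
  have weak : ∀ v ∈ {v : ℝ | ∃ μ : ℝ, 0 ≤ μ ∧
      v = (1 / lam) * OmegaF P d μ lam - (μ / lam) * Δ}, v ≤ Rcut P d lam Δ := by
    rintro _ ⟨μ, hμ, rfl⟩
    refine le_csInf ⟨_, q₀, hq₀, hEd₀.trans_le hΔ, rfl⟩ ?_
    rintro _ ⟨q, hq, hqΔ, rfl⟩
    have h := csInf_le (hObdd μ hμ) ⟨q, hq, rfl⟩
    change OmegaF P d μ lam ≤ _ at h
    rw [hobj] at h
    change _ ≤ cutoffObjective P (1 / lam) q
    have h2 := mul_le_mul_of_nonneg_left hqΔ hμ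
    have h3 : (1 / lam) * OmegaF P d μ lam - (μ / lam) * Δ =
        (OmegaF P d μ lam - μ * Δ) / lam := by ring
    rw [h3, div_le_iff₀ hlam]
    linarith
  refine le_antisymm (le_of_forall_pos_sub_le fun ε hε => ?_)
    (csSup_le ⟨_, 0, le_rfl, rfl⟩ weak)
  obtain ⟨ν, hν, hνq⟩ := exists_multiplier (r := Rcut P d lam Δ - ε) (b := Δ)
    (g := fun q => Ed q d) hK hfv
    ⟨convex_setOf_isJoint, fun p _ q _ s t _ _ _ => (Ed_combo s t p q d).le⟩ hfc
    (continuous_Ed d).continuousOn ⟨q₀, hq₀, hEd₀.trans_le hΔ⟩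
    fun q hq hqΔ => (sub_lt_self _ hε).trans_le (csInf_le hRbdd ⟨q, hq, hqΔ, rfl⟩)
  refine le_csSup_of_le ⟨_, weak⟩ ⟨lam * ν, mul_nonneg hlam.le hν, rfl⟩ ?_
  have h : lam * (Rcut P d lam Δ - ε + ν * Δ) ≤ OmegaF P d (lam * ν) lam := by
    refine le_csInf ⟨_, q₀, hq₀, rfl⟩ ?_
    rintro _ ⟨q, hq, rfl⟩
    rw [hobj, mul_assoc, ← mul_add]
    refine mul_le_mul_of_nonneg_left ?_ hlam.le
    linarith [hνq q hq]
  have h2 : (1 / lam) * OmegaF P d (lam * ν) lam - (lam * ν / lam) * Δ =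
      OmegaF P d (lam * ν) lam / lam - ν * Δ := by field_simp
  rw [h2, le_sub_iff_add_le, le_div_iff₀ hlam]
  linarith
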